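/- arXiv:1811.04333 — 6 statements merged into one kernel-verified Lean document; each statement's English description precedes it below -/
import Mathlib

section
/- Let x : ℝ → ℝ be a twice differentiable solution of the PIPM dynamics x''(t) = ω² · (x(t) − x_f), and let I ⊆ ℝ be an interval on which x'(t) > 0. Then the cotangent (phase-progression) quantity t ↦ x'(t)^(ω²) · (x(t) − x_f) is strictly monotonically increasing on I; consequently, for any ζ₀ > 0 and any initial state (x₀, v₀) with v₀ > 0 and x₀ > x_f, the cotangent manifold value ζ(x(t), x'(t)) = ζ₀ · (x'(t)/v₀)^(ω²) · (x(t) − x_f)/(x₀ − x_f) is strictly increasing along the trajectory on I. -/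
/-- If `y' > 0` on an interval and `y''` equals `c * (y - a)` with `c ≥ 0`, then
`(y')^p * (y - a)` is strictly increasing there for every exponent `p ≥ 0`. -/
theorem strictMonoOn_deriv_rpow_mul_sub {c p a : ℝ} (hc : 0 ≤ c) (hp : 0 ≤ p) {y : ℝ → ℝ}
    (hy : Differentiable ℝ y) (hy' : Differentiable ℝ (deriv y)) {I : Set ℝ}
    (hI : I.OrdConnected) (hode : ∀ t ∈ I, deriv (deriv y) t = c * (y t - a))
    (hpos : ∀ t ∈ I, 0 < deriv y t) :
    StrictMonoOn (fun t => deriv y t ^ p * (y t - a)) I := by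
  have hderiv : ∀ t ∈ I, HasDerivAt (fun t => deriv y t ^ p * (y t - a))
      (c * (y t - a) * p * deriv y t ^ (p - 1) * (y t - a) + deriv y t ^ p * deriv y t) t := by
    intro t ht
    have h := (hy' t).hasDerivAt
    rw [hode t ht] at h
    exact (h.rpow_const (Or.inl (hpos t ht).ne')).mul ((hy t).hasDerivAt.sub_const a)
  refine strictMonoOn_of_deriv_pos hI.convex
    (fun t ht => (hderiv t ht).continuousAt.continuousWithinAt) fun t ht => ?_
  have htI := interior_subset ht
  have hv := hpos t htI
  rw [(hderiv t htI).deriv]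
  have hsq : 0 ≤ c * p * deriv y t ^ (p - 1) * (y t - a) ^ 2 := by positivity
  have hlast : 0 < deriv y t ^ p * deriv y t := by positivity
  linarith

/-- Along any PIPM trajectory on an interval where `x' > 0`, the cotangent
(phase-progression) quantity `x'^(ω²) (x − x_f)` is strictly increasing, and
consequently so is the cotangent manifold value
`ζ₀ (x'/v₀)^(ω²) (x − x_f)/(x₀ − x_f)`. -/
theorem pipm_cotangent_strictMono (ω x_f ζ₀ x₀ v₀ : ℝ) (hω : 0 < ω)
    (hζ₀ : 0 < ζ₀) (hv₀ : 0 < v₀) (hx₀ : x_f < x₀)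
    (x : ℝ → ℝ) (hx : Differentiable ℝ x) (hx' : Differentiable ℝ (deriv x))
    (hode : ∀ t, deriv (deriv x) t = ω ^ 2 * (x t - x_f))
    (I : Set ℝ) (hI : I.OrdConnected) (hpos : ∀ t ∈ I, 0 < deriv x t) :
    StrictMonoOn (fun t => (deriv x t) ^ (ω ^ 2 : ℝ) * (x t - x_f)) I ∧
    StrictMonoOn
      (fun t => ζ₀ * (deriv x t / v₀) ^ (ω ^ 2 : ℝ) * (x t - x_f) / (x₀ - x_f)) I := by
  have hmono := strictMonoOn_deriv_rpow_mul_sub (sq_nonneg ω) (sq_nonneg ω) hx hx' hI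
    (fun t _ => hode t) hpos
  refine ⟨hmono, ?_⟩
  have hd : 0 < x₀ - x_f := sub_pos.2 hx₀
  have hk : 0 < ζ₀ / (v₀ ^ (ω ^ 2 : ℝ) * (x₀ - x_f)) := by positivity
  refine ((strictMono_mul_left_of_pos hk).comp_strictMonoOn hmono).congr fun t ht => ?_
  simp only [Function.comp_apply, Real.div_rpow (hpos t ht).le hv₀.le]
  field_simp
end

section
/- Define F, G : ℝ × (0, ∞) → ℝ by F(x, v) = v² − ω² · (x − x_f)² (the PIPM tangent manifold level function) and G(x, v) = v^(ω²) · (x − x_f) (the PIPM cotangent manifold level function). Then at every point (x, v) with v > 0 the Euclidean gradients of F and G are orthogonal: (∂F/∂x)(x,v) · (∂G/∂x)(x,v) + (∂F/∂v)(x,v) · (∂G/∂v)(x,v) = 0. -/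
/-- At every phase-space point `(x, v)` with `v > 0`, the gradients of the
PIPM tangent manifold level function `F(x,v) = v² − ω²(x − x_f)²` and of the
PIPM cotangent manifold level function `G(x,v) = v^(ω²)(x − x_f)` are
orthogonal. -/
theorem pipm_manifolds_orthogonal (ω x_f : ℝ) (hω : 0 < ω) (x v : ℝ) (hv : 0 < v) :
    deriv (fun x' : ℝ => v ^ 2 - ω ^ 2 * (x' - x_f) ^ 2) x *
        deriv (fun x' : ℝ => v ^ (ω ^ 2 : ℝ) * (x' - x_f)) x +
      deriv (fun v' : ℝ => v' ^ 2 - ω ^ 2 * (x - x_f) ^ 2) v *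
        deriv (fun v' : ℝ => v' ^ (ω ^ 2 : ℝ) * (x - x_f)) v = 0 := by
  have hFx : HasDerivAt (fun x' : ℝ => v ^ 2 - ω ^ 2 * (x' - x_f) ^ 2)
      (-(2 * ω ^ 2 * (x - x_f))) x := by
    refine (((((hasDerivAt_id' x).sub_const x_f).pow 2).const_mul (ω ^ 2)).const_sub
      (v ^ 2)).congr_deriv ?_
    push_cast
    ring
  have hGx : HasDerivAt (fun x' : ℝ => v ^ (ω ^ 2 : ℝ) * (x' - x_f)) (v ^ (ω ^ 2 : ℝ)) x := by
    simpa using ((hasDerivAt_id' x).sub_const x_f).const_mul (v ^ (ω ^ 2 : ℝ))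
  have hFv : HasDerivAt (fun v' : ℝ => v' ^ 2 - ω ^ 2 * (x - x_f) ^ 2) (2 * v) v := by
    simpa using (hasDerivAt_pow 2 v).sub_const (ω ^ 2 * (x - x_f) ^ 2)
  have hGv : HasDerivAt (fun v' : ℝ => v' ^ (ω ^ 2 : ℝ) * (x - x_f))
      (ω ^ 2 * v ^ (ω ^ 2 - 1 : ℝ) * (x - x_f)) v :=
    (Real.hasDerivAt_rpow_const (Or.inl hv.ne')).mul_const (x - x_f)
  rw [hFx.deriv, hGx.deriv, hFv.deriv, hGv.deriv, Real.rpow_sub_one hv.ne']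
  field_simp
  ring
end

section
/- Let x : ℝ → ℝ be a twice differentiable solution of the PPM dynamics x''(t) = −ω² · (x(t) − x_h), and let I ⊆ ℝ be an interval on which x'(t) > 0. Then the cotangent (phase-progression) quantity t ↦ x'(t)^(−ω²) · (x(t) − x_h) is strictly monotonically increasing on I. -/
/-- The derivative of the cotangent quantity along a PPM trajectory, at a time of positive
velocity. -/
theorem hasDerivAt_ppm_cotangent {ω x_h v t : ℝ} {x x' : ℝ → ℝ} (hv : x' t = v) (hpos : 0 < v)
    (hx : HasDerivAt x v t) (hx' : HasDerivAt x' (-ω ^ 2 * (x t - x_h)) t) :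
    HasDerivAt (fun s => x' s ^ (-(ω ^ 2) : ℝ) * (x s - x_h))
      (v ^ (-(ω ^ 2) - 1 : ℝ) * (v ^ 2 + (ω ^ 2 * (x t - x_h)) ^ 2)) t := by
  subst hv
  refine ((hx'.rpow_const (p := -(ω ^ 2)) (Or.inl hpos.ne')).mul
    (hx.sub_const x_h)).congr_deriv ?_
  have h : x' t ^ (-(ω ^ 2) : ℝ) = x' t ^ (-(ω ^ 2) - 1 : ℝ) * x' t := by
    rw [← Real.rpow_add_one hpos.ne', sub_add_cancel]
  rw [h]
  ring

/-- Along any PPM trajectory on an interval where `x' > 0`, the cotangent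
(phase-progression) quantity `x'^(−ω²) (x − x_h)` is strictly increasing. -/
theorem ppm_cotangent_strictMono (ω x_h : ℝ) (hω : 0 < ω)
    (x : ℝ → ℝ) (hx : Differentiable ℝ x) (hx' : Differentiable ℝ (deriv x))
    (hode : ∀ t, deriv (deriv x) t = -ω ^ 2 * (x t - x_h))
    (I : Set ℝ) (hI : I.OrdConnected) (hpos : ∀ t ∈ I, 0 < deriv x t) :
    StrictMonoOn (fun t => (deriv x t) ^ (-(ω ^ 2) : ℝ) * (x t - x_h)) I := by
  have hderiv := fun t (ht : t ∈ I) => hasDerivAt_ppm_cotangent rfl (hpos t ht)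
    (hx t).hasDerivAt (hode t ▸ (hx' t).hasDerivAt)
  refine strictMonoOn_of_deriv_pos hI.convex
    (fun t ht => (hderiv t ht).continuousAt.continuousWithinAt) fun t ht => ?_
  have hv := hpos t (interior_subset ht)
  rw [(hderiv t (interior_subset ht)).deriv]
  positivity
end

section
/- Define F, G : ℝ × (0, ∞) → ℝ by F(x, v) = v² + ω² · (x − x_h)² (the PPM tangent manifold level function) and G(x, v) = v^(−ω²) · (x − x_h) (the PPM cotangent manifold level function). Then at every point (x, v) with v > 0 the Euclidean gradients of F and G are orthogonal: (∂F/∂x)(x,v) · (∂G/∂x)(x,v) + (∂F/∂v)(x,v) · (∂G/∂v)(x,v) = 0. -/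
/-- At every phase-space point `(x, v)` with `v > 0`, the gradients of the
PPM tangent manifold level function `F(x,v) = v² + ω²(x − x_h)²` and of the
PPM cotangent manifold level function `G(x,v) = v^(−ω²)(x − x_h)` are
orthogonal. -/
theorem ppm_manifolds_orthogonal (ω x_h : ℝ) (hω : 0 < ω) (x v : ℝ) (hv : 0 < v) :
    deriv (fun x' : ℝ => v ^ 2 + ω ^ 2 * (x' - x_h) ^ 2) x *
        deriv (fun x' : ℝ => v ^ (-(ω ^ 2) : ℝ) * (x' - x_h)) x +
      deriv (fun v' : ℝ => v' ^ 2 + ω ^ 2 * (x - x_h) ^ 2) v *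
        deriv (fun v' : ℝ => v' ^ (-(ω ^ 2) : ℝ) * (x - x_h)) v = 0 := by
  have hFx : HasDerivAt (fun x' : ℝ => v ^ 2 + ω ^ 2 * (x' - x_h) ^ 2)
      (ω ^ 2 * (2 * (x - x_h))) x := by
    simpa using ((((hasDerivAt_id x).sub_const x_h).pow 2).const_mul (ω ^ 2)).const_add (v ^ 2)
  have hGx : HasDerivAt (fun x' : ℝ => v ^ (-(ω ^ 2) : ℝ) * (x' - x_h))
      (v ^ (-(ω ^ 2) : ℝ)) x := by
    simpa using ((hasDerivAt_id x).sub_const x_h).const_mul (v ^ (-(ω ^ 2) : ℝ))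
  have hFv : HasDerivAt (fun v' : ℝ => v' ^ 2 + ω ^ 2 * (x - x_h) ^ 2) (2 * v) v := by
    simpa using (hasDerivAt_pow 2 v).add_const (ω ^ 2 * (x - x_h) ^ 2)
  have hGv := (Real.hasDerivAt_rpow_const (p := -(ω ^ 2)) (Or.inl hv.ne')).mul_const (x - x_h)
  rw [hFx.deriv, hGx.deriv, hFv.deriv, hGv.deriv, Real.rpow_sub_one hv.ne']
  field_simp
  ring
end

section
/- Let Q and A be types, T : Q → A → Q → Prop a (nondeterministic) transition relation, and G : Set Q a target set. Define Win : Q → Prop as the least predicate satisfying: (i) if q ∈ G then Win q; and (ii) if there exists an action a with (∃ q', T q a q') and (∀ q', T q a q' → Win q'), then Win q. Then there exists a memoryless strategy k : Q → A such that for every state q with Win q and every infinite run q₀ = q with T qᵢ (k qᵢ) qᵢ₊₁ for all i ∈ ℕ, there exists an index n with qₙ ∈ G; i.e., every run controlled by the strategy k from a winning state reaches the target set G in finitely many steps regardless of the nondeterministic resolution of transitions. -/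
/-- The winning set of the reachability game on a nondeterministic transition
system `T` with target set `G`: the least predicate containing `G` and closed
under controllable predecessors. -/
inductive Win {Q A : Type*} (T : Q → A → Q → Prop) (G : Set Q) : Q → Prop
  | mem : ∀ q, q ∈ G → Win T G q
  | step : ∀ q a, (∃ q', T q a q') → (∀ q', T q a q' → Win T G q') → Win T G q

universe u v

/-- `WinBy T G o q` says that the target set `G` can be enforced from `q` while the ordinal bound
`o` strictly decreases along every transition. -/
inductive WinBy {Q : Type u} {A : Type v} (T : Q → A → Q → Prop) (G : Set Q) :
    Ordinal.{u} → Q → Prop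
  | mem : ∀ o q, q ∈ G → WinBy T G o q
  | step : ∀ o q a (r : Q → Ordinal.{u}), (∀ q', T q a q' → r q' < o) →
      (∀ q', T q a q' → WinBy T G (r q') q') → WinBy T G o q

theorem Win.exists_winBy {Q : Type u} {A : Type v} {T : Q → A → Q → Prop} {G : Set Q} {q : Q}
    (h : Win T G q) : ∃ o, WinBy T G o q := by
  classical
  induction h with
  | mem q hq => exact ⟨0, .mem 0 q hq⟩
  | step q a _ _ ih =>
    choose r hr using ih
    let s : Q → Ordinal.{u} := fun q' => if h : T q a q' then r q' h else 0
    refine ⟨Order.succ (⨆ q', s q'), .step _ q a s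
      (fun q' _ => Order.lt_succ_of_le (Ordinal.le_iSup s q')) fun q' h => ?_⟩
    simpa [s, h] using hr q' h

/-- There are a rank function and a memoryless strategy that decreases the rank along every
transition from a ranked state outside the target set. -/
theorem exists_rank_strategy {Q : Type u} {A : Type v} [Nonempty A]
    (T : Q → A → Q → Prop) (G : Set Q) :
    ∃ (rank : Q → Ordinal.{u}) (k : Q → A), ∀ q, (∃ o, WinBy T G o q) → q ∉ G →
      ∀ q', T q (k q) q' → (∃ o, WinBy T G o q') ∧ rank q' < rank q := by
  let rank : Q → Ordinal.{u} := fun q => sInf {o | WinBy T G o q}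
  have key : ∀ q, ∃ a, (∃ o, WinBy T G o q) → q ∉ G →
      ∀ q', T q a q' → (∃ o, WinBy T G o q') ∧ rank q' < rank q := by
    intro q
    by_cases h : (∃ o, WinBy T G o q) ∧ q ∉ G
    · have hmin : WinBy T G (rank q) q := csInf_mem (s := {o | WinBy T G o q}) h.1
      cases hmin with
      | mem _ _ hq => exact absurd hq h.2
      | step _ _ a r hlt hwin =>
        exact ⟨a, fun _ _ q' hT => ⟨⟨r q', hwin q' hT⟩,
          (csInf_le' (s := {o | WinBy T G o q'}) (hwin q' hT)).trans_lt (hlt q' hT)⟩⟩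
    · exact ⟨Classical.arbitrary A, fun h₁ h₂ => absurd ⟨h₁, h₂⟩ h⟩
  choose k hk using key
  exact ⟨rank, k, hk⟩

/-- Correctness of backward reachability control synthesis: there is a
memoryless strategy `k` such that every `k`-controlled run from a winning
state reaches the target set `G` in finitely many steps, regardless of the
nondeterministic resolution of transitions. -/
theorem reachability_controller_correct {Q A : Type*} [Nonempty A]
    (T : Q → A → Q → Prop) (G : Set Q) :
    ∃ k : Q → A, ∀ run : ℕ → Q, Win T G (run 0) →
      (∀ i : ℕ, T (run i) (k (run i)) (run (i + 1))) → ∃ n : ℕ, run n ∈ G := by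
  obtain ⟨rank, k, hk⟩ := exists_rank_strategy T G
  refine ⟨k, fun run h₀ hrun => ?_⟩
  by_contra! hG
  have hwin : ∀ n, ∃ o, WinBy T G o (run n) := by
    intro n
    induction n with
    | zero => exact h₀.exists_winBy
    | succ n ih => exact (hk _ ih (hG n) _ (hrun n)).1
  exact not_strictAnti_of_wellFoundedLT (fun n => rank (run n))
    (strictAnti_nat_of_succ_lt fun n => (hk _ (hwin n) (hG n) _ (hrun n)).2)
end

section
/- Let Ξ, Q, A be types, M : Ξ → Q an abstraction map, Step : Ξ → A → Ξ → Prop the concrete one-time-step transition relation (under a control action and all bounded disturbances), and T : Q → A → Q → Prop an abstract transition relation that over-approximates the concrete dynamics, i.e., for all ξ, ξ' ∈ Ξ and a ∈ A, Step ξ a ξ' implies T (M ξ) a (M ξ'). Let G : Set Q be a target set and let Win : Q → Prop be the least predicate satisfying: (i) if q ∈ G then Win q; and (ii) if there exists a with (∃ q', T q a q') and (∀ q', T q a q' → Win q'), then Win q. Then there exists a function k : Q → A such that for every initial state ξ₀ ∈ Ξ with Win (M ξ₀) and every infinite concrete run (ξᵢ) with Step ξᵢ (k (M ξᵢ)) ξᵢ₊₁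 for all i ∈ ℕ, there exists an index n with M ξₙ ∈ G. In other words, if the reachability goal is realizable for the over-approximating finite abstraction, then the refined controller ξ ↦ k(M ξ) realizes it for the concrete system under all bounded disturbances. -/
universe u v

/-- `WinWithin T G o q`: from `q` the controller can force reaching `G` while decreasing an
ordinal rank bounded by `o` at every transition. -/
inductive WinWithin {Q : Type u} {A : Type v} (T : Q → A → Q → Prop) (G : Set Q) :
    Ordinal.{u} → Q → Prop
  | mem : ∀ o q, q ∈ G → WinWithin T G o q
  | step : ∀ o q a (f : Q → Ordinal.{u}), (∀ q', T q a q' → f q' < o) →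
      (∀ q', T q a q' → WinWithin T G (f q') q') → WinWithin T G o q

theorem Win.exists_winWithin {Q : Type u} {A : Type v} {T : Q → A → Q → Prop} {G : Set Q}
    {q : Q} (h : Win T G q) : ∃ o, WinWithin T G o q := by
  induction h with
  | mem q hq => exact ⟨0, .mem 0 q hq⟩
  | step q a _ _ ih =>
    choose! f hf using ih
    refine ⟨Order.succ (⨆ q', f q'), .step _ q a f (fun q' _ => ?_) hf⟩
    exact Order.lt_succ_of_le (Ordinal.le_iSup f q')

/-- A single memoryless strategy decreases the rank of every ranked state outside `G`. -/
theorem exists_rank_decreasing_strategy {Q : Type u} {A : Type v} [Nonempty A]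
    (T : Q → A → Q → Prop) (G : Set Q) :
    ∃ k : Q → A, ∀ o q, WinWithin T G o q → q ∉ G →
      ∀ q', T q (k q) q' → ∃ o' < o, WinWithin T G o' q' := by
  have key : ∀ q, ∃ a, ∀ o, WinWithin T G o q → q ∉ G →
      ∀ q', T q a q' → ∃ o' < o, WinWithin T G o' q' := by
    intro q
    by_cases hq : ∃ o, WinWithin T G o q
    · obtain ⟨m, hm, hmin⟩ := WellFounded.has_min Ordinal.lt_wf {o | WinWithin T G o q} hq
      cases hm with
      | mem _ _ hG => exact ⟨Classical.arbitrary A, fun _ _ h => absurd hG h⟩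
      | step _ _ a f hlt hf =>
        exact ⟨a, fun o ho _ q' hq' =>
          ⟨f q', (hlt q' hq').trans_le (not_lt.mp (hmin o ho)), hf q' hq'⟩⟩
    · exact ⟨Classical.arbitrary A, fun o ho => absurd ⟨o, ho⟩ hq⟩
  choose k hk using key
  exact ⟨k, fun o q => hk q o⟩

/-- One-walking-step robust reachability via abstraction: if the abstract
transition relation `T` over-approximates the concrete one-time-step dynamics
`Step` through the abstraction map `M`, and the reachability goal `G` is
realizable for the abstraction (winning set `Win`), then the refined
controller `ξ ↦ k (M ξ)` realizes the goal for the concrete system under all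
bounded disturbances. -/
theorem abstraction_refined_reachability {Ξ Q A : Type*} [Nonempty A]
    (M : Ξ → Q) (Step : Ξ → A → Ξ → Prop) (T : Q → A → Q → Prop)
    (hover : ∀ (ξ ξ' : Ξ) (a : A), Step ξ a ξ' → T (M ξ) a (M ξ'))
    (G : Set Q) :
    ∃ k : Q → A, ∀ run : ℕ → Ξ, Win T G (M (run 0)) →
      (∀ i : ℕ, Step (run i) (k (M (run i))) (run (i + 1))) →
      ∃ n : ℕ, M (run n) ∈ G := by
  obtain ⟨k, hk⟩ := exists_rank_decreasing_strategy T G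
  refine ⟨k, fun run hwin hrun => ?_⟩
  obtain ⟨o, ho⟩ := hwin.exists_winWithin
  suffices ∀ o i, WinWithin T G o (M (run i)) → ∃ n, M (run n) ∈ G from this o 0 ho
  intro o
  induction o using WellFoundedLT.induction with
  | ind o ih =>
    intro i hi
    by_cases hG : M (run i) ∈ G
    · exact ⟨i, hG⟩
    · obtain ⟨o', hlt, ho'⟩ := hk o _ hi hG _ (hover _ _ _ (hrun i))
      exact ih o' hlt (i + 1) ho'
end
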